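/- Let k be a field and for i = 1, 2 let R_i = k[X,Y,Z]/(X^{n_i}Y - Z² - h_i(X)Z) with n_i ≥ 2, h_i(0) ≠ 0, and deg h_i < n_i. If R_1 and R_2 are isomorphic as k-algebras, then n_1 = n_2 and h_2(X) = η h_1(μX) for some η, μ ∈ k*. -/

import Mathlib

noncomputable section

/-- The defining relation `XⁿY - Z² - h(X)Z` in `k[X,Y,Z]` (variables `X 0, X 1, X 2`). -/
def danRel (k : Type*) [Field k] (n : ℕ) (h : Polynomial k) : MvPolynomial (Fin 3) k :=
  MvPolynomial.X 0 ^ n * MvPolynomial.X 1 - MvPolynomial.X 2 ^ 2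
    - Polynomial.aeval (MvPolynomial.X 0 : MvPolynomial (Fin 3) k) h * MvPolynomial.X 2

/-- The coordinate ring `R = k[X,Y,Z]/(XⁿY - Z² - h(X)Z)` of a Danielewski surface. -/
abbrev DanRing (k : Type*) [Field k] (n : ℕ) (h : Polynomial k) : Type _ :=
  MvPolynomial (Fin 3) k ⧸ Ideal.span {danRel k n h}

/-- The image `x` of `X` in `R`. -/
def dx (k : Type*) [Field k] (n : ℕ) (h : Polynomial k) : DanRing k n h :=
  Ideal.Quotient.mk _ (MvPolynomial.X 0)

/-- The image `y` of `Y` in `R`. -/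
def dy (k : Type*) [Field k] (n : ℕ) (h : Polynomial k) : DanRing k n h :=
  Ideal.Quotient.mk _ (MvPolynomial.X 1)

/-- The image `z` of `Z` in `R`. -/
def dz (k : Type*) [Field k] (n : ℕ) (h : Polynomial k) : DanRing k n h :=
  Ideal.Quotient.mk _ (MvPolynomial.X 2)

namespace DanRing

open Polynomial

section Basic

variable {k : Type*} [Field k] {n : ℕ} {h : k[X]}

theorem relation : dx k n h ^ n * dy k n h = dz k n h ^ 2 + aeval (dx k n h) h * dz k n h := by
  have H : Ideal.Quotient.mk (Ideal.span {danRel k n h}) (danRel k n h) = 0 :=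
    Ideal.Quotient.eq_zero_iff_mem.2 (Ideal.subset_span rfl)
  have hx : Ideal.Quotient.mk (Ideal.span {danRel k n h})
      (aeval (MvPolynomial.X 0 : MvPolynomial (Fin 3) k) h) = aeval (dx k n h) h := by
    rw [← Ideal.Quotient.mkₐ_eq_mk k, ← aeval_algHom_apply]
    rfl
  conv at H => enter [1, 2]; rw [danRel]
  rw [map_sub, map_sub, map_mul, map_mul, map_pow, map_pow, hx] at H
  change dx k n h ^ n * dy k n h - dz k n h ^ 2 - aeval (dx k n h) h * dz k n h = 0 at H
  linear_combination H

/-- The universal property of the coordinate ring. -/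
def lift {A : Type*} [CommRing A] [Algebra k A] {a b c : A}
    (H : a ^ n * b = c ^ 2 + aeval a h * c) : DanRing k n h →ₐ[k] A :=
  Ideal.Quotient.liftₐ _ (MvPolynomial.aeval ![a, b, c]) (by
    intro r hr
    have : Ideal.span {danRel k n h} ≤
        RingHom.ker (MvPolynomial.aeval ![a, b, c] : MvPolynomial (Fin 3) k →ₐ[k] A) := by
      rw [Ideal.span_singleton_le_iff_mem, RingHom.mem_ker, danRel]
      simp only [map_sub, map_mul, map_pow, ← aeval_algHom_apply, MvPolynomial.aeval_X]
      simp [H]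
    exact this hr)

section lift

variable {A : Type*} [CommRing A] [Algebra k A] {a b c : A}
  (H : a ^ n * b = c ^ 2 + aeval a h * c)

@[simp] theorem lift_dx : lift H (dx k n h) = a := by
  change MvPolynomial.aeval ![a, b, c] (MvPolynomial.X 0 : MvPolynomial (Fin 3) k) = a
  simp

@[simp] theorem lift_dy : lift H (dy k n h) = b := by
  change MvPolynomial.aeval ![a, b, c] (MvPolynomial.X 1 : MvPolynomial (Fin 3) k) = b
  simp

@[simp] theorem lift_dz : lift H (dz k n h) = c := by
  change MvPolynomial.aeval ![a, b, c] (MvPolynomial.X 2 : MvPolynomial (Fin 3) k) = c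
  simp

end lift

theorem induction {p : DanRing k n h → Prop} (hC : ∀ a, p (algebraMap k _ a))
    (hadd : ∀ r s, p r → p s → p (r + s)) (hx : ∀ r, p r → p (r * dx k n h))
    (hy : ∀ r, p r → p (r * dy k n h)) (hz : ∀ r, p r → p (r * dz k n h)) (r : DanRing k n h) :
    p r := by
  obtain ⟨r, rfl⟩ := Ideal.Quotient.mk_surjective r
  induction r using MvPolynomial.induction_on with
  | C a => exact hC a
  | add r s hr hs => rw [map_add]; exact hadd _ _ hr hs
  | mul_X r i hr =>
    rw [map_mul]
    fin_cases i
    exacts [hx _ hr, hy _ hr, hz _ hr]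

theorem ringHom_ext {A : Type*} [CommRing A] {f g : DanRing k n h →+* A}
    (hC : ∀ a, f (algebraMap k _ a) = g (algebraMap k _ a))
    (hx : f (dx k n h) = g (dx k n h)) (hy : f (dy k n h) = g (dy k n h))
    (hz : f (dz k n h) = g (dz k n h)) : f = g := by
  refine RingHom.ext fun r => ?_
  induction r using induction with
  | hC a => exact hC a
  | hadd r s hr hs => rw [map_add, map_add, hr, hs]
  | hx r hr => rw [map_mul, map_mul, hr, hx]
  | hy r hr => rw [map_mul, map_mul, hr, hy]
  | hz r hr => rw [map_mul, map_mul, hr, hz]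

variable (k n h) in
/-- The standard basis of `R` over `k[x]`. -/
def mon (i : ℕ) : DanRing k n h := dy k n h ^ (i / 2) * dz k n h ^ (i % 2)

theorem mon_zero : mon k n h 0 = 1 := by simp [mon]

theorem mon_one : mon k n h 1 = dz k n h := by simp [mon]

theorem mon_two : mon k n h 2 = dy k n h := by simp [mon]

theorem mon_mul_dy (i : ℕ) : mon k n h i * dy k n h = mon k n h (i + 2) := by
  rw [mon, mon, Nat.add_div_right _ two_pos, Nat.add_mod_right, pow_succ]
  ring

theorem mon_two_mul (i : ℕ) : mon k n h (2 * i) = dy k n h ^ i := by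
  simp [mon]

theorem mon_two_mul_add_one (i : ℕ) : mon k n h (2 * i + 1) = dy k n h ^ i * dz k n h := by
  rw [mon, show (2 * i + 1) / 2 = i by lia, show (2 * i + 1) % 2 = 1 by lia, pow_one]

/-- The element of `R` with given coordinates in the standard basis over `k[x]`. -/
def ofCoord (P : k[X][X]) : DanRing k n h := P.sum fun i a => aeval (dx k n h) a * mon k n h i

theorem ofCoord_add (P Q : k[X][X]) :
    (ofCoord (P + Q) : DanRing k n h) = ofCoord P + ofCoord Q :=
  sum_add_index _ _ _ (by simp) (by simp [add_mul])

theorem ofCoord_monomial (i : ℕ) (a : k[X]) :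
    (ofCoord (monomial i a) : DanRing k n h) = aeval (dx k n h) a * mon k n h i :=
  sum_monomial_index _ _ (by simp)

theorem exists_ofCoord (r : DanRing k n h) : ∃ P : k[X][X], r = ofCoord P := by
  have key (g : DanRing k n h)
      (hg : ∀ i, ∃ Q : k[X][X], mon k n h i * g = ofCoord Q) (r : DanRing k n h)
      (hr : ∃ P : k[X][X], r = ofCoord P) : ∃ P : k[X][X], r * g = ofCoord P := by
    obtain ⟨P, rfl⟩ := hr
    induction P using Polynomial.induction_on' with
    | add P Q hP hQ =>
      obtain ⟨P', hP⟩ := hP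
      obtain ⟨Q', hQ⟩ := hQ
      exact ⟨P' + Q', by rw [ofCoord_add, ofCoord_add, add_mul, hP, hQ]⟩
    | monomial i a =>
      obtain ⟨Q, hQ⟩ := hg i
      refine ⟨C a * Q, ?_⟩
      rw [ofCoord_monomial, mul_assoc, hQ]
      clear hQ
      induction Q using Polynomial.induction_on' with
      | add P Q hP hQ => rw [mul_add, ofCoord_add, ofCoord_add, mul_add, hP, hQ]
      | monomial j b =>
        rw [C_mul_monomial, ofCoord_monomial, ofCoord_monomial, map_mul, mul_assoc]
  induction r using induction with
  | hC a => exact ⟨monomial 0 (C a), by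
      rw [ofCoord_monomial, mon_zero, mul_one, aeval_C]⟩
  | hadd r s hr hs =>
    obtain ⟨P, rfl⟩ := hr
    obtain ⟨Q, rfl⟩ := hs
    exact ⟨P + Q, (ofCoord_add _ _).symm⟩
  | hx r hr =>
    exact key _ (fun i => ⟨monomial i X, by rw [ofCoord_monomial, aeval_X, mul_comm]⟩) r hr
  | hy r hr =>
    exact key _ (fun i => ⟨monomial (i + 2) 1, by
      rw [ofCoord_monomial, map_one, one_mul, mon_mul_dy]⟩) r hr
  | hz r hr =>
    refine key _ (fun i => ?_) r hr
    obtain ⟨j, rfl | rfl⟩ := Nat.even_or_odd' i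
    · exact ⟨monomial (2 * j + 1) 1, by
        rw [ofCoord_monomial, map_one, one_mul, mon_two_mul, mon_two_mul_add_one]⟩
    · refine ⟨monomial (2 * (j + 1)) (X ^ n) + monomial (2 * j + 1) (-h), ?_⟩
      rw [ofCoord_add, ofCoord_monomial, ofCoord_monomial, mon_two_mul, mon_two_mul_add_one,
        map_pow, aeval_X, map_neg]
      linear_combination (-dy k n h ^ j) * relation (k := k) (n := n) (h := h)

variable (k n h) in
/-- The embedding of `R` into `k(s)[w]` with `x = s²`, `z = sⁿ w`. -/
def emb : DanRing k n h →ₐ[k] (RatFunc k)[X] :=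
  lift (a := C (RatFunc.X ^ 2))
    (b := X ^ 2 + C (aeval (RatFunc.X ^ 2 : RatFunc k) h / RatFunc.X ^ n) * X)
    (c := C (RatFunc.X ^ n) * X) (by
      have h1 : aeval (C (RatFunc.X ^ 2 : RatFunc k)) h
          = C (aeval (RatFunc.X ^ 2 : RatFunc k) h) := by
        rw [← algebraMap_eq, aeval_algebraMap_apply]
      have h2 : C (RatFunc.X ^ 2 : RatFunc k) ^ n *
          C (aeval (RatFunc.X ^ 2 : RatFunc k) h / RatFunc.X ^ n)
          = C (RatFunc.X ^ n) * C (aeval (RatFunc.X ^ 2 : RatFunc k) h) := by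
        rw [← C_pow, ← C_mul, ← C_mul]
        congr 1
        have : (RatFunc.X : RatFunc k) ≠ 0 := RatFunc.X_ne_zero
        field_simp
        ring
      have h3 : C (RatFunc.X ^ 2 : RatFunc k) ^ n = C (RatFunc.X ^ n) ^ 2 := by
        rw [← C_pow, ← C_pow]; congr 1; ring
      rw [h1]
      linear_combination h2 * X + h3 * X ^ 2)

theorem emb_aeval_dx (p : k[X]) :
    emb k n h (aeval (dx k n h) p) = C (algebraMap k[X] (RatFunc k) (expand k 2 p)) := by
  rw [← aeval_algHom_apply, emb, lift_dx, ← algebraMap_eq, aeval_algebraMap_apply, expand_eq_sum]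
  congr 1
  rw [aeval_eq_sum_range, sum_over_range _ (by simp), map_sum]
  simp [Algebra.smul_def, RatFunc.algebraMap_X]

theorem emb_dz : emb k n h (dz k n h) = C (RatFunc.X ^ n) * X := lift_dz _

theorem emb_dy : emb k n h (dy k n h) =
    X ^ 2 + C (aeval (RatFunc.X ^ 2 : RatFunc k) h / RatFunc.X ^ n) * X := lift_dy _

theorem degree_emb_dy_tail :
    (C (aeval (RatFunc.X ^ 2 : RatFunc k) h / RatFunc.X ^ n) * X : (RatFunc k)[X]).degree
      < (X ^ 2 : (RatFunc k)[X]).degree := by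
  rw [degree_X_pow]
  exact (degree_C_mul_X_le _).trans_lt (by norm_num)

theorem degree_emb_dy : (emb k n h (dy k n h)).degree = 2 := by
  rw [emb_dy, degree_add_eq_left_of_degree_lt degree_emb_dy_tail, degree_X_pow]
  rfl

theorem leadingCoeff_emb_dy : (emb k n h (dy k n h)).leadingCoeff = 1 := by
  rw [emb_dy, leadingCoeff_add_of_degree_lt' degree_emb_dy_tail, leadingCoeff_X_pow]

theorem degree_emb_dz : (emb k n h (dz k n h)).degree = 1 := by
  rw [emb_dz, degree_C_mul_X (pow_ne_zero _ RatFunc.X_ne_zero)]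

theorem leadingCoeff_emb_dz : (emb k n h (dz k n h)).leadingCoeff = RatFunc.X ^ n := by
  rw [emb_dz, leadingCoeff_mul, leadingCoeff_C, leadingCoeff_X, mul_one]

theorem degree_emb_mon (i : ℕ) : (emb k n h (mon k n h i)).degree = i := by
  rw [mon, map_mul, map_pow, map_pow, degree_mul, degree_pow, degree_pow, degree_emb_dy,
    degree_emb_dz]
  simp only [nsmul_eq_mul]
  norm_cast
  lia

theorem leadingCoeff_emb_mon (i : ℕ) :
    (emb k n h (mon k n h i)).leadingCoeff = RatFunc.X ^ (n * (i % 2)) := by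
  rw [mon, map_mul, map_pow, map_pow, leadingCoeff_mul, leadingCoeff_pow, leadingCoeff_pow,
    leadingCoeff_emb_dy, leadingCoeff_emb_dz, one_pow, one_mul, pow_mul]

theorem algebraMap_expand_ne_zero {p : k[X]} (hp : p ≠ 0) :
    algebraMap k[X] (RatFunc k) (expand k 2 p) ≠ 0 := by
  simpa [expand_eq_zero two_pos] using hp

theorem degree_emb_term {p : k[X]} (hp : p ≠ 0) (i : ℕ) :
    (emb k n h (aeval (dx k n h) p * mon k n h i)).degree = i := by
  rw [map_mul, emb_aeval_dx, degree_C_mul (algebraMap_expand_ne_zero hp), degree_emb_mon]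

theorem degree_emb_ofCoord_le (P : k[X][X]) :
    (emb k n h (ofCoord P)).degree ≤ P.degree := by
  rw [ofCoord, Polynomial.sum, map_sum]
  refine (degree_sum_le _ _).trans (Finset.sup_le fun i hi => ?_)
  rw [degree_emb_term (mem_support_iff.1 hi)]
  exact le_degree_of_mem_supp _ hi

theorem exists_leading (r : DanRing k n h) (hr : r ≠ 0) : ∃ (d : ℕ) (p : k[X]) (r' : DanRing k n h),
    p ≠ 0 ∧ r = aeval (dx k n h) p * mon k n h d + r' ∧ (emb k n h r').degree < d ∧
      (emb k n h r).degree = d ∧ (emb k n h r).leadingCoeff =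
        algebraMap k[X] (RatFunc k) (expand k 2 p * X ^ (n * (d % 2))) := by
  obtain ⟨P, rfl⟩ := exists_ofCoord r
  have hP : P ≠ 0 := by rintro rfl; exact hr (by simp [ofCoord])
  have hlt : (emb k n h (ofCoord P.eraseLead)).degree < P.natDegree := by
    rw [← degree_eq_natDegree hP]
    exact (degree_emb_ofCoord_le _).trans_lt (degree_eraseLead_lt hP)
  have hlc : P.leadingCoeff ≠ 0 := leadingCoeff_ne_zero.2 hP
  have heq : ofCoord P = aeval (dx k n h) P.leadingCoeff * mon k n h P.natDegree
      + ofCoord P.eraseLead := by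
    conv_lhs => rw [← eraseLead_add_monomial_natDegree_leadingCoeff P]
    rw [ofCoord_add, ofCoord_monomial, add_comm]
  have hlt' := hlt
  rw [← degree_emb_term (n := n) (h := h) hlc P.natDegree] at hlt'
  refine ⟨P.natDegree, P.leadingCoeff, _, hlc, heq, hlt, ?_, ?_⟩
  · rw [heq, map_add, degree_add_eq_left_of_degree_lt hlt', degree_emb_term hlc]
  · rw [heq, map_add, leadingCoeff_add_of_degree_lt' hlt', map_mul, leadingCoeff_mul,
      emb_aeval_dx, leadingCoeff_C, leadingCoeff_emb_mon, map_mul, map_pow, RatFunc.algebraMap_X]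

theorem emb_injective : Function.Injective (emb k n h) := by
  rw [injective_iff_map_eq_zero]
  intro r hr
  by_contra hne
  obtain ⟨d, p, r', -, -, -, hd, -⟩ := exists_leading r hne
  rw [hr, degree_zero] at hd
  exact absurd hd (by simp)

end Basic

section Weight

variable {K : Type*} [CommRing K]

/-- The substitution of weight `-1` for `w` and weight `τ` for `T` into polynomials in `w, T`;
the leading coefficient of the result is the dehomogenized leading form. -/
def weightHom (K : Type*) [CommRing K] (τ : ℚ) : K[X][X] →+* HahnSeries ℚ K[X] :=
  eval₂RingHom (eval₂RingHom (HahnSeries.C.comp C) (HahnSeries.single (-1) 1))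
    (HahnSeries.single τ X)

theorem weightHom_monomial (τ : ℚ) (i j : ℕ) (a : K) :
    weightHom K τ (monomial j (monomial i a)) =
      HahnSeries.single (τ * j - i) (monomial j a) := by
  simp only [weightHom, coe_eval₂RingHom, eval₂_monomial, RingHom.coe_comp, Function.comp_apply,
    HahnSeries.C_apply, HahnSeries.single_pow, HahnSeries.single_mul_single, one_pow,
    mul_one, C_mul_X_pow_eq_monomial, nsmul_eq_mul]
  congr 1
  ring_nf

theorem coeff_weightHom (τ : ℚ) (P : K[X][X]) (i j : ℕ) :
    ((weightHom K τ P).coeff (τ * j - i)).coeff j = (P.coeff j).coeff i := by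
  induction P using Polynomial.induction_on' with
  | add P Q hP hQ => simp [hP, hQ]
  | monomial j' p =>
    induction p using Polynomial.induction_on' with
    | add p q hp hq => simp [hp, hq]
    | monomial i' a =>
      rw [weightHom_monomial, HahnSeries.coeff_single, coeff_monomial]
      by_cases hj : j' = j
      · subst hj
        simp only [sub_right_inj, Nat.cast_inj, if_true, coeff_monomial, eq_comm (a := i)]
        split_ifs <;> simp
      · split_ifs <;> simp [coeff_monomial, hj]

theorem coeff_weightHom_eq_zero (τ : ℚ) (P : K[X][X]) (q : ℚ) (j : ℕ)
    (hq : ∀ i : ℕ, q ≠ τ * j - i) : ((weightHom K τ P).coeff q).coeff j = 0 := by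
  induction P using Polynomial.induction_on' with
  | add P Q hP hQ => simp [hP, hQ]
  | monomial j' p =>
    induction p using Polynomial.induction_on' with
    | add p q hp hq => simp [hp, hq]
    | monomial i' a =>
      rw [weightHom_monomial, HahnSeries.coeff_single]
      split_ifs with h
      · rw [coeff_monomial, if_neg]
        rintro rfl
        exact hq _ h
      · simp

theorem le_orderTop_weightHom {τ : ℚ} {P : K[X][X]} {d : ℚ}
    (hP : ∀ i j : ℕ, (P.coeff j).coeff i ≠ 0 → (i : ℚ) ≤ d + τ * j) :
    ((-d : ℚ) : WithTop ℚ) ≤ (weightHom K τ P).orderTop := by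
  rw [HahnSeries.le_orderTop_iff_forall]
  intro q hq
  rw [WithTop.coe_lt_coe] at hq
  ext j
  rw [coeff_zero]
  by_cases h : ∃ i : ℕ, q = τ * j - i
  · obtain ⟨i, rfl⟩ := h
    rw [coeff_weightHom]
    by_contra hne
    linarith [hP i j hne]
  · push Not at h
    exact coeff_weightHom_eq_zero τ P q j h

/-- For a finite family of polynomials in `T` over `K[w]`, the steepest slope of a segment joining
the point `(0, d g)` to a point of the Newton polygon. -/
theorem exists_slope {ι : Type*} [Fintype ι] (P : ι → K[X][X]) (d : ι → ℕ)
    (hd : ∀ g, ((P g).coeff 0).natDegree ≤ d g) (hP : ∃ g j, 1 ≤ j ∧ (P g).coeff j ≠ 0) :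
    ∃ τ : ℚ, (∀ g, ∀ i j : ℕ, ((P g).coeff j).coeff i ≠ 0 → (i : ℚ) ≤ d g + τ * j) ∧
      ∃ g, ∃ i j : ℕ, 1 ≤ j ∧ (i : ℚ) = d g + τ * j ∧ ((P g).coeff j).coeff i ≠ 0 := by
  classical
  let S : Finset ℚ := Finset.univ.biUnion fun g => ((P g).support.filter (1 ≤ ·)).image
    fun j => ((((P g).coeff j).natDegree : ℚ) - d g) / j
  have hS : S.Nonempty := by
    obtain ⟨g, j, hj, hne⟩ := hP
    exact ⟨_, Finset.mem_biUnion.2 ⟨g, Finset.mem_univ _, Finset.mem_image_of_mem _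
      (Finset.mem_filter.2 ⟨mem_support_iff.2 hne, hj⟩)⟩⟩
  refine ⟨S.max' hS, fun g i j hij => ?_, ?_⟩
  · have hi : (i : ℚ) ≤ ((P g).coeff j).natDegree := by exact_mod_cast le_natDegree_of_ne_zero hij
    rcases Nat.eq_zero_or_pos j with rfl | hj
    · have : (((P g).coeff 0).natDegree : ℚ) ≤ d g := by exact_mod_cast hd g
      simpa using hi.trans this
    · have hne : (P g).coeff j ≠ 0 := by intro h; simp [h] at hij
      have := S.le_max' _ (Finset.mem_biUnion.2 ⟨g, Finset.mem_univ _, Finset.mem_image_of_mem _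
        (Finset.mem_filter.2 ⟨mem_support_iff.2 hne, hj⟩)⟩)
      rw [div_le_iff₀ (by exact_mod_cast hj)] at this
      linarith
  · have hmem := S.max'_mem hS
    obtain ⟨g, -, hg⟩ := Finset.mem_biUnion.1 hmem
    obtain ⟨j, hj, hjeq⟩ := Finset.mem_image.1 hg
    rw [Finset.mem_filter, mem_support_iff] at hj
    refine ⟨g, ((P g).coeff j).natDegree, j, hj.2, ?_, ?_⟩
    · rw [← hjeq]
      have : (j : ℚ) ≠ 0 := by exact_mod_cast (Nat.one_le_iff_ne_zero.1 hj.2)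
      field_simp
      ring
    · exact leadingCoeff_ne_zero.2 hj.1

theorem le_orderTop_mul {a b : ℚ} {x y : HahnSeries ℚ K} (hx : (a : WithTop ℚ) ≤ x.orderTop)
    (hy : (b : WithTop ℚ) ≤ y.orderTop) : ((a + b : ℚ) : WithTop ℚ) ≤ (x * y).orderTop := by
  rw [WithTop.coe_add]
  exact (add_le_add hx hy).trans HahnSeries.orderTop_add_le_mul

theorem le_orderTop_pow {a : ℚ} {x : HahnSeries ℚ K} (hx : (a : WithTop ℚ) ≤ x.orderTop)
    (m : ℕ) : ((m * a : ℚ) : WithTop ℚ) ≤ (x ^ m).orderTop := by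
  induction m with
  | zero => simpa using HahnSeries.orderTop_single_le (a := (0 : ℚ)) (r := (1 : K))
  | succ m ih =>
    rw [pow_succ]
    convert le_orderTop_mul ih hx using 2
    push_cast
    ring

theorem le_orderTop_add {a : WithTop ℚ} {x y : HahnSeries ℚ K} (hx : a ≤ x.orderTop)
    (hy : a ≤ y.orderTop) : a ≤ (x + y).orderTop :=
  (le_min hx hy).trans HahnSeries.min_orderTop_le_orderTop_add

end Weight

section Parity

/-- The divisibility statement behind the conductor argument: `E` is the set of exponents of even
weight. -/
theorem C_X_dvd_of_mul {k : Type*} [Field k] {n : ℕ} (hn : 2 ≤ n) (E : AddSubgroup ℤ)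
    {P Q V : k[X][X]} (hPQ : Q = P * V) (hP0 : P.coeff 0 = X ^ 2) (hQ0 : Q.coeff 0 = X ^ n)
    (hP : ∀ j : ℕ, (j : ℤ) ∉ E → X ^ n ∣ P.coeff j)
    (hQ : ∀ j : ℕ, (j : ℤ) ∈ E → X ^ n ∣ Q.coeff j) :
    C X ∣ P := by
  classical
  let π : k[X][X] → k[X][X] := fun F =>
    ∑ j ∈ F.support with ((j : ℕ) : ℤ) ∈ E, monomial j (F.coeff j)
  have hπ (F : k[X][X]) (j : ℕ) : (π F).coeff j = if (j : ℤ) ∈ E then F.coeff j else 0 := by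
    simp only [π, finsetSum_coeff, coeff_monomial, Finset.sum_ite_eq', Finset.mem_filter,
      mem_support_iff]
    split_ifs with h1 h2 h2 <;> first | rfl | (exfalso; tauto) | skip
    by_contra h
    exact h1 ⟨fun h' => h h'.symm, h2⟩
  by_contra hndvd
  have hO : C (X ^ n) ∣ P - π P := by
    rw [C_dvd_iff_dvd_coeff]
    intro j
    rw [coeff_sub, hπ]
    split_ifs with h
    · simp
    · simpa using hP j h
  have hE : ¬ C X ∣ π P := by
    intro h
    apply hndvd
    have h2 : C X ∣ P - π P := (_root_.map_dvd C (dvd_pow_self X (by lia))).trans hO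
    simpa using dvd_add h2 h
  have hmul : C (X ^ n) ∣ π P * π V := by
    rw [C_dvd_iff_dvd_coeff]
    intro l
    by_cases hl : (l : ℤ) ∈ E
    · have h1 : (π P * π V).coeff l = (π P * V).coeff l := by
        rw [coeff_mul, coeff_mul]
        refine Finset.sum_congr rfl fun p hp => ?_
        rw [hπ, hπ]
        by_cases h1 : (p.1 : ℤ) ∈ E
        · have h2 : (p.2 : ℤ) ∈ E := by
            have := E.sub_mem hl h1
            rwa [← Finset.HasAntidiagonal.mem_antidiagonal.1 hp, Nat.cast_add,
              add_sub_cancel_left] at this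
          rw [if_pos h1, if_pos h2]
        · rw [if_neg h1, zero_mul, zero_mul]
      rw [h1, show π P * V = Q - (P - π P) * V by rw [hPQ]; ring, coeff_sub]
      exact dvd_sub (hQ l hl) ((C_dvd_iff_dvd_coeff _ _).1 (hO.mul_right V) l)
    · rw [coeff_mul]
      refine Finset.dvd_sum fun p hp => ?_
      rw [hπ, hπ]
      split_ifs with h1 h2
      · rw [← Finset.HasAntidiagonal.mem_antidiagonal.1 hp, Nat.cast_add] at hl
        exact absurd (E.add_mem h1 h2) hl
      all_goals simp
  have hprime : Prime (C X : k[X][X]) := prime_C_iff.2 prime_X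
  have hV : C (X ^ n) ∣ π V := by
    rw [C_pow] at hmul ⊢
    exact hprime.pow_dvd_of_dvd_mul_left n hE hmul
  have hV0 : (X : k[X]) ^ n ∣ V.coeff 0 := by
    have := (C_dvd_iff_dvd_coeff _ _).1 hV 0
    rwa [hπ, if_pos (by simp)] at this
  have h0 : (X : k[X]) ^ n = X ^ 2 * V.coeff 0 := by
    rw [← hQ0, hPQ, mul_coeff_zero, hP0]
  have h3 : (X : k[X]) ^ (2 + n) ∣ X ^ n := by
    conv_rhs => rw [h0]
    rw [pow_add]
    exact mul_dvd_mul_left _ hV0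
  rw [pow_dvd_pow_iff X_ne_zero not_isUnit_X] at h3
  lia

end Parity

/-- Exponential maps, i.e. locally finite iterative higher derivations, or actions of `𝔾ₐ`. -/
structure IsExp {k R : Type*} [Field k] [CommRing R] [Algebra k R] (φ : R →ₐ[k] R[X]) : Prop where
  coeff_zero : ∀ r, (φ r).coeff 0 = r
  map_coeff : ∀ r d, φ ((φ r).coeff d) = hasseDeriv d (φ r)

section Slope

variable {k : Type*} [Field k] {n : ℕ} {h : k[X]}

theorem coeff_emb_of_degree_le {r : DanRing k n h} {i : ℕ} (hr : (emb k n h r).degree ≤ i) :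
    ∃ c : k[X], algebraMap k[X] (RatFunc k) c = (emb k n h r).coeff i ∧ (Odd i → X ^ n ∣ c) := by
  rcases eq_or_ne r 0 with rfl | hr0
  · exact ⟨0, by simp, by simp⟩
  obtain ⟨d, p, r', hp, -, -, hd, hlead⟩ := exists_leading r hr0
  rw [hd, Nat.cast_le] at hr
  rcases hr.eq_or_lt with rfl | hlt
  · refine ⟨expand k 2 p * X ^ (n * (d % 2)), ?_, fun hodd => ?_⟩
    · rw [← hlead, leadingCoeff, natDegree_eq_of_degree_eq_some hd]
    · rw [Nat.odd_iff.1 hodd, mul_one]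
      exact dvd_mul_left _ _
  · exact ⟨0, by rw [map_zero, coeff_eq_zero_of_degree_lt (by rw [hd]; exact_mod_cast hlt)],
      by simp⟩

theorem natDegree_emb_dy : (emb k n h (dy k n h)).natDegree = 2 :=
  natDegree_eq_of_degree_eq_some degree_emb_dy

theorem natDegree_emb_dz : (emb k n h (dz k n h)).natDegree = 1 :=
  natDegree_eq_of_degree_eq_some degree_emb_dz

theorem emb_dx : emb k n h (dx k n h) = C (RatFunc.X ^ 2) := lift_dx _

theorem emb_ne_zero {r : DanRing k n h} (hr : r ≠ 0) : emb k n h r ≠ 0 :=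
  (map_ne_zero_iff _ emb_injective).2 hr

theorem dx_ne_zero : dx k n h ≠ 0 := by
  intro H
  simpa [H, RatFunc.X_ne_zero, eq_comm (a := (0 : (RatFunc k)[X]))]
    using emb_dx (k := k) (n := n) (h := h)

theorem dy_ne_zero : dy k n h ≠ 0 := by
  intro H
  simpa [H] using degree_emb_dy (k := k) (n := n) (h := h)

theorem dz_ne_zero : dz k n h ≠ 0 := by
  intro H
  simpa [H] using degree_emb_dz (k := k) (n := n) (h := h)

theorem natDegree_emb_lt {r : DanRing k n h} {d : ℕ} (hr : r ≠ 0) (h' : (emb k n h r).degree < d) :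
    (emb k n h r).natDegree < d := by
  rwa [← natDegree_lt_iff_degree_lt (emb_ne_zero hr)] at h'

/-- The coordinates `x, y, z`. -/
def gen (k : Type*) [Field k] (n : ℕ) (h : k[X]) : Fin 3 → DanRing k n h :=
  ![dx k n h, dy k n h, dz k n h]

theorem gen_ne_zero (g : Fin 3) : gen k n h g ≠ 0 := by
  fin_cases g
  exacts [dx_ne_zero, dy_ne_zero, dz_ne_zero]

instance : IsDomain (DanRing k n h) :=
  emb_injective.isDomain (emb k n h).toRingHom

variable (φ : DanRing k n h →ₐ[k] (DanRing k n h)[X]) (τ : ℚ)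

/-- The bound on the Newton polygons of `φ x, φ y, φ z` saying that `φ` has slope at most `τ`. -/
def IsSlope : Prop :=
  ∀ g i j, (emb k n h ((φ (gen k n h g)).coeff j)).coeff i ≠ 0 →
    (i : ℚ) ≤ (emb k n h (gen k n h g)).natDegree + τ * j

/-- `φ` followed by the weighted substitution. -/
def expHom : DanRing k n h →+* HahnSeries ℚ (RatFunc k)[X] :=
  (weightHom (RatFunc k) τ).comp
    ((mapRingHom (emb k n h : DanRing k n h →+* (RatFunc k)[X])).comp φ)

/-- The leading form of `φ r`, dehomogenized with respect to `w`. -/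
def form (r : DanRing k n h) : (RatFunc k)[X] := (expHom φ τ r).leadingCoeff

variable {φ τ}

theorem coeff_expHom (r : DanRing k n h) (i j : ℕ) :
    ((expHom φ τ r).coeff (τ * j - i)).coeff j = (emb k n h ((φ r).coeff j)).coeff i := by
  simp [expHom, coeff_weightHom]

theorem le_orderTop_gen (hφ : IsSlope φ τ) (g : Fin 3) :
    ((-((emb k n h (gen k n h g)).natDegree : ℚ) : ℚ) : WithTop ℚ) ≤
      (expHom φ τ (gen k n h g)).orderTop :=
  le_orderTop_weightHom fun i j hij => hφ g i j (by simpa using hij)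

theorem le_orderTop_aeval_dx (hφ : IsSlope φ τ) (p : k[X]) :
    ((0 : ℚ) : WithTop ℚ) ≤ (expHom φ τ (aeval (dx k n h) p)).orderTop := by
  have hx := le_orderTop_gen hφ 0
  rw [show gen k n h 0 = dx k n h from rfl, emb_dx, natDegree_C, Nat.cast_zero, neg_zero] at hx
  have hC (a : k) : ((0 : ℚ) : WithTop ℚ) ≤
      (expHom φ τ (algebraMap k (DanRing k n h) a)).orderTop := by
    rw [← neg_zero]
    refine le_orderTop_weightHom fun i j hij => ?_
    rw [RingHom.comp_apply, coe_mapRingHom, coeff_map, RingHom.coe_coe, RingHom.coe_coe,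
      AlgHom.commutes, Polynomial.algebraMap_apply, coeff_C] at hij
    split_ifs at hij with hj
    · rw [AlgHom.commutes, Polynomial.algebraMap_apply, coeff_C] at hij
      split_ifs at hij with hi
      · simp [hi, hj]
      · exact absurd rfl hij
    · simp at hij
  induction p using Polynomial.induction_on' with
  | add p q hp hq =>
    rw [map_add, map_add]
    exact le_orderTop_add hp hq
  | monomial m a =>
    rw [aeval_monomial, map_mul, map_pow]
    simpa using le_orderTop_mul (hC a) (le_orderTop_pow hx m)

theorem le_orderTop_expHom (hφ : IsSlope φ τ) (N : ℕ) : ∀ r : DanRing k n h,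
    (emb k n h r).natDegree ≤ N → ((-(N : ℚ) : ℚ) : WithTop ℚ) ≤ (expHom φ τ r).orderTop := by
  induction N using Nat.strong_induction_on with
  | _ N ih =>
    intro r hr
    rcases eq_or_ne r 0 with rfl | hr0
    · simp
    obtain ⟨d, p, r', hp, rfl, hd', hd, -⟩ := exists_leading r hr0
    rw [natDegree_eq_of_degree_eq_some hd] at hr
    have hdN : ((-(N : ℚ) : ℚ) : WithTop ℚ) ≤ ((-(d : ℚ) : ℚ) : WithTop ℚ) := by
      rw [WithTop.coe_le_coe, neg_le_neg_iff]
      exact_mod_cast hr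
    rw [map_add]
    refine le_orderTop_add (hdN.trans ?_) ?_
    · have hy := le_orderTop_gen hφ 1
      have hz := le_orderTop_gen hφ 2
      rw [show gen k n h 1 = dy k n h from rfl, natDegree_emb_dy] at hy
      rw [show gen k n h 2 = dz k n h from rfl, natDegree_emb_dz] at hz
      rw [map_mul, mon, map_mul, map_pow, map_pow]
      convert le_orderTop_mul (le_orderTop_aeval_dx hφ p)
        (le_orderTop_mul (le_orderTop_pow hy (d / 2)) (le_orderTop_pow hz (d % 2))) using 2
      conv_lhs => rw [← Nat.div_add_mod d 2]
      push_cast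
      ring
    · rcases eq_or_ne r' 0 with rfl | hr'0
      · simp
      have hlt := natDegree_emb_lt hr'0 hd'
      refine le_trans ?_ (ih _ (hlt.trans_le hr) r' le_rfl)
      rw [WithTop.coe_le_coe, neg_le_neg_iff]
      exact_mod_cast (hlt.trans_le hr).le

theorem orderTop_expHom (h0 : ∀ r, (φ r).coeff 0 = r) (hφ : IsSlope φ τ) {r : DanRing k n h}
    (hr : r ≠ 0) :
    (expHom φ τ r).orderTop = ((-((emb k n h r).natDegree : ℚ) : ℚ) : WithTop ℚ) := by
  refine le_antisymm (HahnSeries.orderTop_le_of_coeff_ne_zero fun H => ?_)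
    (le_orderTop_expHom hφ _ r le_rfl)
  have := coeff_expHom (φ := φ) (τ := τ) r (emb k n h r).natDegree 0
  rw [h0, Nat.cast_zero, mul_zero, zero_sub, H, coeff_zero, coeff_natDegree] at this
  exact leadingCoeff_ne_zero.2 (emb_ne_zero hr) this.symm

theorem le_of_coeff_ne_zero (hφ : IsSlope φ τ) {r : DanRing k n h} {i j : ℕ}
    (hij : (emb k n h ((φ r).coeff j)).coeff i ≠ 0) :
    (i : ℚ) ≤ (emb k n h r).natDegree + τ * j := by
  by_contra hlt
  apply hij
  rw [← coeff_expHom (φ := φ) (τ := τ), HahnSeries.coeff_eq_zero_of_lt_orderTop, coeff_zero]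
  refine lt_of_lt_of_le ?_ (le_orderTop_expHom hφ _ r le_rfl)
  rw [WithTop.coe_lt_coe]
  linarith

theorem form_eq (h0 : ∀ r, (φ r).coeff 0 = r) (hφ : IsSlope φ τ) {r : DanRing k n h} (hr : r ≠ 0) :
    form φ τ r = (expHom φ τ r).coeff (-((emb k n h r).natDegree : ℚ)) := by
  rw [form, ← HahnSeries.coeff_untop_eq_leadingCoeff
    (by rw [orderTop_expHom h0 hφ hr]; exact WithTop.coe_ne_top)]
  congr 1
  rw [WithTop.untop_eq_iff, orderTop_expHom h0 hφ hr]

theorem coeff_form (h0 : ∀ r, (φ r).coeff 0 = r) (hφ : IsSlope φ τ) {r : DanRing k n h}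
    (hr : r ≠ 0) {i j : ℕ} (hij : (i : ℚ) = (emb k n h r).natDegree + τ * j) :
    (form φ τ r).coeff j = (emb k n h ((φ r).coeff j)).coeff i := by
  rw [form_eq h0 hφ hr, ← coeff_expHom (φ := φ) (τ := τ)]
  congr 2
  linarith

theorem coeff_form_eq_zero (h0 : ∀ r, (φ r).coeff 0 = r) (hφ : IsSlope φ τ) {r : DanRing k n h}
    (hr : r ≠ 0) {j : ℕ} (hij : ∀ i : ℕ, (i : ℚ) ≠ (emb k n h r).natDegree + τ * j) :
    (form φ τ r).coeff j = 0 := by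
  rw [form_eq h0 hφ hr, expHom, RingHom.comp_apply, coeff_weightHom_eq_zero]
  intro i hi
  exact hij i (by linarith)

theorem form_ne_zero (h0 : ∀ r, (φ r).coeff 0 = r) (hφ : IsSlope φ τ) {r : DanRing k n h}
    (hr : r ≠ 0) : form φ τ r ≠ 0 := by
  rw [form, HahnSeries.leadingCoeff_ne_zero, ← HahnSeries.orderTop_ne_top,
    orderTop_expHom h0 hφ hr]
  exact WithTop.coe_ne_top

theorem form_mul (r s : DanRing k n h) : form φ τ (r * s) = form φ τ r * form φ τ s := by
  exact (congrArg _ (map_mul _ r s)).trans (HahnSeries.leadingCoeff_mul _ _)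

theorem form_one : form φ τ (1 : DanRing k n h) = 1 := by
  rw [form, map_one, HahnSeries.leadingCoeff_one]

theorem form_pow (r : DanRing k n h) (m : ℕ) : form φ τ (r ^ m) = form φ τ r ^ m := by
  induction m with
  | zero => simp [form_one]
  | succ m ih => rw [pow_succ, form_mul, ih, pow_succ]

theorem form_add (h0 : ∀ r, (φ r).coeff 0 = r) (hφ : IsSlope φ τ) {r s : DanRing k n h}
    (hs : (emb k n h s).degree < (emb k n h r).degree) : form φ τ (r + s) = form φ τ r := by
  rcases eq_or_ne s 0 with rfl | hs0
  · rw [add_zero]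
  have hr0 : r ≠ 0 := by
    rintro rfl
    simp at hs
  have H : (expHom φ τ r).orderTop < (expHom φ τ s).orderTop := ?_
  · exact (congrArg _ (map_add _ r s)).trans (HahnSeries.leadingCoeff_add_eq_left H)
  rw [orderTop_expHom h0 hφ hr0, orderTop_expHom h0 hφ hs0, WithTop.coe_lt_coe, neg_lt_neg_iff,
    Nat.cast_lt]
  exact natDegree_lt_natDegree (emb_ne_zero hs0) hs

theorem exists_form_eq (h0 : ∀ r, (φ r).coeff 0 = r) (hφ : IsSlope φ τ) {r : DanRing k n h}
    (hr : r ≠ 0) : ∃ p : k[X], p ≠ 0 ∧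
      form φ τ r = form φ τ (aeval (dx k n h) p) * form φ τ (mon k n h (emb k n h r).natDegree) ∧
      (emb k n h r).leadingCoeff = algebraMap k[X] (RatFunc k)
        (expand k 2 p * X ^ (n * ((emb k n h r).natDegree % 2))) := by
  obtain ⟨d, p, r', hp, hr', hd', hd, hlead⟩ := exists_leading r hr
  have hdn := natDegree_eq_of_degree_eq_some hd
  refine ⟨p, hp, ?_, by rw [hlead, hdn]⟩
  conv_lhs => rw [hr']
  rw [form_add h0 hφ (by rwa [degree_emb_term hp]), form_mul, hdn]

theorem form_relation (h0 : ∀ r, (φ r).coeff 0 = r) (hφ : IsSlope φ τ) :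
    form φ τ (dx k n h) ^ n * form φ τ (dy k n h) = form φ τ (dz k n h) ^ 2 := by
  rw [← form_pow, ← form_mul, relation, form_add h0 hφ, form_pow]
  rw [map_mul, emb_aeval_dx, map_pow, degree_pow, degree_emb_dz, ← smul_eq_C_mul]
  refine (degree_smul_le _ _).trans_lt ?_
  rw [degree_emb_dz]
  norm_num

theorem exists_map_eq_form (h0 : ∀ r, (φ r).coeff 0 = r) (hφ : IsSlope φ τ) {r : DanRing k n h}
    (hr : r ≠ 0) : ∃ P : k[X][X], P.map (algebraMap k[X] (RatFunc k)) = form φ τ r ∧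
      ∀ j : ℕ, (∀ m : ℤ, ((emb k n h r).natDegree + τ * j : ℚ) ≠ 2 * m) → X ^ n ∣ P.coeff j := by
  have key (j : ℕ) : ∃ c : k[X], algebraMap k[X] (RatFunc k) c = (form φ τ r).coeff j ∧
      ((∀ m : ℤ, ((emb k n h r).natDegree + τ * j : ℚ) ≠ 2 * m) → X ^ n ∣ c) := by
    by_cases hi : ∃ i : ℕ, (i : ℚ) = (emb k n h r).natDegree + τ * j
    · obtain ⟨i, hi⟩ := hi
      have hle : (emb k n h ((φ r).coeff j)).degree ≤ i := by
        rw [degree_le_iff_coeff_zero]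
        intro i' hi'
        by_contra hne
        have := le_of_coeff_ne_zero hφ hne
        rw [← hi, Nat.cast_le] at this
        rw [Nat.cast_lt] at hi'
        lia
      obtain ⟨c, hc, hc'⟩ := coeff_emb_of_degree_le hle
      refine ⟨c, by rw [hc, coeff_form h0 hφ hr hi], fun hm => hc' ?_⟩
      rw [← Nat.not_even_iff_odd]
      rintro ⟨m, rfl⟩
      refine hm m ?_
      rw [← hi]
      push_cast
      ring
    · push Not at hi
      exact ⟨0, by rw [map_zero, coeff_form_eq_zero h0 hφ hr hi], by simp⟩
  obtain ⟨P, hP⟩ := (mem_lifts (form φ τ r)).1 ((lifts_iff_coeff_lifts _).2 fun j =>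
    (key j).imp fun c hc => hc.1)
  refine ⟨P, hP, fun j hj => ?_⟩
  obtain ⟨c, hc, hc'⟩ := key j
  rw [← hP, coeff_map] at hc
  rw [← IsFractionRing.injective k[X] (RatFunc k) hc]
  exact hc' hj

theorem coeff_zero_form (h0 : ∀ r, (φ r).coeff 0 = r) (hφ : IsSlope φ τ) {r : DanRing k n h}
    (hr : r ≠ 0) : (form φ τ r).coeff 0 = (emb k n h r).leadingCoeff := by
  rw [coeff_form h0 hφ hr (i := (emb k n h r).natDegree) (by simp), h0, coeff_natDegree]

/-- Every coefficient of the leading form of `φ x` is divisible by `s`. -/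
theorem exists_map_eq_form_dx (hn : 2 ≤ n) (h0 : ∀ r, (φ r).coeff 0 = r) (hφ : IsSlope φ τ) :
    ∃ P : k[X][X], P.map (algebraMap k[X] (RatFunc k)) = form φ τ (dx k n h) ∧ C X ∣ P := by
  have hinj := IsFractionRing.injective k[X] (RatFunc k)
  obtain ⟨P, hP, hP'⟩ := exists_map_eq_form h0 hφ (dx_ne_zero (k := k) (n := n) (h := h))
  obtain ⟨Q, hQ, hQ'⟩ := exists_map_eq_form h0 hφ (dz_ne_zero (k := k) (n := n) (h := h))
  obtain ⟨Y, hY, -⟩ := exists_map_eq_form h0 hφ (dy_ne_zero (k := k) (n := n) (h := h))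
  refine ⟨P, hP, ?_⟩
  have hrel : P ^ n * Y = Q ^ 2 := by
    apply map_injective _ hinj
    rw [Polynomial.map_mul, Polynomial.map_pow, Polynomial.map_pow, hP, hQ, hY,
      form_relation h0 hφ]
  have hdvd : P ∣ Q := by
    rw [← IsIntegrallyClosed.pow_dvd_pow_iff two_ne_zero, ← hrel]
    exact (pow_dvd_pow P hn).mul_right _
  obtain ⟨V, hV⟩ := hdvd
  let E : AddSubgroup ℤ :=
    { carrier := {j | ∃ m : ℤ, τ * j = 2 * m}
      zero_mem' := ⟨0, by simp⟩
      add_mem' := by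
        rintro a b ⟨m, hm⟩ ⟨l, hl⟩
        exact ⟨m + l, by push_cast; linarith⟩
      neg_mem' := by
        rintro a ⟨m, hm⟩
        exact ⟨-m, by push_cast; linarith⟩ }
  refine C_X_dvd_of_mul hn E hV ?_ ?_ ?_ ?_
  · apply hinj
    rw [← coeff_map, hP, coeff_zero_form h0 hφ dx_ne_zero, emb_dx, leadingCoeff_C, map_pow,
      RatFunc.algebraMap_X]
  · apply hinj
    rw [← coeff_map, hQ, coeff_zero_form h0 hφ dz_ne_zero, leadingCoeff_emb_dz, map_pow,
      RatFunc.algebraMap_X]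
  · refine fun j hj => hP' j fun m hm => hj ⟨m, ?_⟩
    rw [← hm, emb_dx, natDegree_C]
    simp
  · rintro j ⟨m, hm⟩
    refine hQ' j fun l hl => ?_
    rw [natDegree_emb_dz] at hl
    have : (1 + 2 * m : ℚ) = 2 * l := by
      rw [← hm, ← hl]
      simp
    norm_cast at this
    lia

theorem natDegree_form_mul (h0 : ∀ r, (φ r).coeff 0 = r) (hφ : IsSlope φ τ) {r s : DanRing k n h}
    (hr : r ≠ 0) (hs : s ≠ 0) :
    (form φ τ (r * s)).natDegree = (form φ τ r).natDegree + (form φ τ s).natDegree := by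
  rw [form_mul, natDegree_mul (form_ne_zero h0 hφ hr) (form_ne_zero h0 hφ hs)]

theorem natDegree_form_relation (h0 : ∀ r, (φ r).coeff 0 = r) (hφ : IsSlope φ τ) :
    n * (form φ τ (dx k n h)).natDegree + (form φ τ (dy k n h)).natDegree =
      2 * (form φ τ (dz k n h)).natDegree := by
  rw [← natDegree_pow, ← natDegree_pow, ← form_relation h0 hφ, natDegree_mul
    (pow_ne_zero _ (form_ne_zero h0 hφ dx_ne_zero)) (form_ne_zero h0 hφ dy_ne_zero)]

theorem aeval_dx_ne_zero {p : k[X]} (hp : p ≠ 0) : aeval (dx k n h) p ≠ 0 := by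
  intro H
  have := emb_aeval_dx (n := n) (h := h) p
  rw [H, map_zero, eq_comm, C_eq_zero] at this
  exact algebraMap_expand_ne_zero hp this

theorem natDegree_form_mon (h0 : ∀ r, (φ r).coeff 0 = r) (hφ : IsSlope φ τ) (d : ℕ) :
    (form φ τ (mon k n h d)).natDegree =
    d / 2 * (form φ τ (dy k n h)).natDegree + d % 2 * (form φ τ (dz k n h)).natDegree := by
  rw [mon, natDegree_form_mul h0 hφ (pow_ne_zero _ dy_ne_zero) (pow_ne_zero _ dz_ne_zero), form_pow,
    form_pow, natDegree_pow, natDegree_pow]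

theorem natDegree_form_dx (hn : 2 ≤ n) (hexp : IsExp φ) (hφ : IsSlope φ τ) :
    (form φ τ (dx k n h)).natDegree = 0 := by
  have h0 := hexp.coeff_zero
  set d := (form φ τ (dx k n h)).natDegree with hd
  by_contra hd0
  have hx : (form φ τ (dx k n h)).coeff d ≠ 0 :=
    leadingCoeff_ne_zero.2 (form_ne_zero h0 hφ dx_ne_zero)
  set r := (φ (dx k n h)).coeff d with hr
  have hDx : (emb k n h (dx k n h)).natDegree = 0 := by rw [emb_dx, natDegree_C]
  obtain ⟨i, hi⟩ : ∃ i : ℕ, (i : ℚ) = (emb k n h (dx k n h)).natDegree + τ * d := by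
    by_contra H
    push Not at H
    exact hx (coeff_form_eq_zero h0 hφ dx_ne_zero H)
  have hcoeff := coeff_form h0 hφ dx_ne_zero hi
  rw [← hr] at hcoeff
  have hri : (emb k n h r).coeff i ≠ 0 := hcoeff ▸ hx
  have hr0 : r ≠ 0 := by
    intro H
    simp [H] at hri
  have hDr : (emb k n h r).natDegree = i := by
    refine le_antisymm ?_ (le_natDegree_of_ne_zero hri)
    have := le_of_coeff_ne_zero hφ (r := dx k n h) (j := d)
      (leadingCoeff_ne_zero.2 (emb_ne_zero hr0))
    rw [← hi] at this
    exact_mod_cast this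
  have hform : (form φ τ r).natDegree = 0 := by
    rw [natDegree_eq_zero_iff_degree_le_zero, degree_le_iff_coeff_zero]
    intro j hj
    by_cases H : ∃ l : ℕ, (l : ℚ) = (emb k n h r).natDegree + τ * j
    · obtain ⟨l, hl⟩ := H
      rw [coeff_form h0 hφ hr0 hl, hexp.map_coeff, hasseDeriv_coeff, map_mul, map_natCast,
        ← C_eq_natCast, coeff_C_mul, ← coeff_form h0 hφ dx_ne_zero (i := l) (j := j + d),
        coeff_eq_zero_of_natDegree_lt, mul_zero]
      · have : 0 < j := by exact_mod_cast hj
        lia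
      · rw [hl, hDr, hi]
        push_cast
        ring
    · push Not at H
      exact coeff_form_eq_zero h0 hφ hr0 H
  obtain ⟨p, hp, hpr, hlead⟩ := exists_form_eq h0 hφ hr0
  have hmon : mon k n h (emb k n h r).natDegree ≠ 0 :=
    mul_ne_zero (pow_ne_zero _ dy_ne_zero) (pow_ne_zero _ dz_ne_zero)
  rw [← form_mul] at hpr
  rw [hpr, natDegree_form_mul h0 hφ (aeval_dx_ne_zero hp) hmon, natDegree_form_mon h0 hφ,
    Nat.add_eq_zero_iff, Nat.add_eq_zero_iff] at hform
  obtain ⟨hform, -, hform'⟩ := hform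
  rcases Nat.mod_two_eq_zero_or_one (emb k n h r).natDegree with hpar | hpar
  · obtain ⟨P, hP, hP'⟩ := exists_map_eq_form_dx hn h0 hφ
    have hX : X ∣ expand k 2 p := by
      have := (C_dvd_iff_dvd_coeff _ _).1 hP' d
      rwa [IsFractionRing.injective k[X] (RatFunc k) (a₁ := P.coeff d) (a₂ := expand k 2 p)] at this
      rw [← coeff_map, hP, hcoeff, ← hDr, coeff_natDegree, hlead, hpar, mul_zero, pow_zero, mul_one]
    rw [X_dvd_iff, show 0 = 0 * 2 by rfl, coeff_expand_mul two_pos, ← X_dvd_iff] at hX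
    obtain ⟨q, rfl⟩ := hX
    rw [map_mul, aeval_X, natDegree_form_mul h0 hφ dx_ne_zero
      (aeval_dx_ne_zero (right_ne_zero_of_mul hp))] at hform
    lia
  · have := natDegree_form_relation h0 hφ
    rw [hpar, one_mul] at hform'
    rw [hform', ← hd] at this
    simp only [mul_zero, Nat.add_eq_zero_iff, mul_eq_zero] at this
    lia

/-- The invariants of a nontrivial exponential map on `R` lie in `k[x]`. -/
theorem exists_aeval_dx_eq (hn : 2 ≤ n) (hexp : IsExp φ) (hnt : ∃ r, φ r ≠ C r)
    {f : DanRing k n h} (hf : φ f = C f) : ∃ p : k[X], f = aeval (dx k n h) p := by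
  have h0 := hexp.coeff_zero
  rcases eq_or_ne f 0 with rfl | hf0
  · exact ⟨0, by simp⟩
  have hgen : ∃ g j, 1 ≤ j ∧ (φ (gen k n h g)).coeff j ≠ 0 := by
    by_contra! H
    have key (g : Fin 3) : φ (gen k n h g) = C (gen k n h g) := by
      ext j
      rcases Nat.eq_zero_or_pos j with rfl | hj
      · rw [h0, coeff_C_zero]
      · rw [H g j hj, coeff_C_of_ne_zero hj.ne']
    obtain ⟨r, hr⟩ := hnt
    have H : (φ : DanRing k n h →+* (DanRing k n h)[X]) = C :=
      ringHom_ext (A := (DanRing k n h)[X]) φ.commutes (key 0) (key 1) (key 2)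
    exact hr (DFunLike.congr_fun H r)
  obtain ⟨τ, hτ, g₀, i₀, j₀, hj₀, hij₀, hne₀⟩ := exists_slope
    (fun g => (φ (gen k n h g)).map (emb k n h : DanRing k n h →+* (RatFunc k)[X]))
    (fun g => (emb k n h (gen k n h g)).natDegree)
    (fun g => by rw [coeff_map, h0]; rfl) (by
      obtain ⟨g, j, hj, hne⟩ := hgen
      exact ⟨g, j, hj, by rw [coeff_map]; exact emb_ne_zero hne⟩)
  have hφ : IsSlope φ τ := fun g i j hij => hτ g i j (by rwa [coeff_map])
  have hx := natDegree_form_dx hn hexp hφ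
  have hrel := natDegree_form_relation h0 hφ
  rw [hx, mul_zero, zero_add] at hrel
  have hpos : (form φ τ (dz k n h)).natDegree ≠ 0 := by
    intro hz
    rw [hz, mul_zero] at hrel
    have hall : (form φ τ (gen k n h g₀)).natDegree = 0 := by
      fin_cases g₀
      exacts [hx, hrel, hz]
    rw [coeff_map, RingHom.coe_coe, ← coeff_form h0 hφ (gen_ne_zero g₀) hij₀] at hne₀
    have := le_natDegree_of_ne_zero hne₀
    lia
  have hform : (form φ τ f).natDegree = 0 := by
    rw [natDegree_eq_zero_iff_degree_le_zero, degree_le_iff_coeff_zero]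
    intro j hj
    by_cases H : ∃ l : ℕ, (l : ℚ) = (emb k n h f).natDegree + τ * j
    · obtain ⟨l, hl⟩ := H
      have hj' : j ≠ 0 := by
        rintro rfl
        simp at hj
      rw [coeff_form h0 hφ hf0 hl, hf, coeff_C_of_ne_zero hj', map_zero, coeff_zero]
    · push Not at H
      exact coeff_form_eq_zero h0 hφ hf0 H
  obtain ⟨d, p, r', hp, hfr, hr', hd, -⟩ := exists_leading f hf0
  have hmon : mon k n h d ≠ 0 :=
    mul_ne_zero (pow_ne_zero _ dy_ne_zero) (pow_ne_zero _ dz_ne_zero)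
  rw [hfr, form_add h0 hφ (by rwa [degree_emb_term hp]),
    natDegree_form_mul h0 hφ (aeval_dx_ne_zero hp) hmon, natDegree_form_mon h0 hφ, hrel] at hform
  have hd0 : d = 0 := by
    by_contra hd0
    rcases Nat.eq_zero_or_pos (d / 2) with h2 | h2
    · have : d % 2 = 1 := by lia
      rw [this] at hform
      lia
    · have := Nat.le_mul_of_pos_left (2 * (form φ τ (dz k n h)).natDegree) h2
      lia
  subst hd0
  have hr0 : r' = 0 := by
    by_contra hne
    simpa using natDegree_emb_lt hne hr'
  exact ⟨p, by rw [hfr, hr0, mon_zero, mul_one, add_zero]⟩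

end Slope

section StandardExp

variable {k : Type*} [Field k] {n : ℕ} {h : k[X]}

variable (k n h) in
/-- The standard exponential map of `R`, fixing `x` and sending `z` to `z + xⁿ T`. -/
def stdExp : DanRing k n h →ₐ[k] (DanRing k n h)[X] :=
  lift (a := C (dx k n h))
    (b := C (dy k n h) + C (2 * dz k n h + aeval (dx k n h) h) * X + C (dx k n h ^ n) * X ^ 2)
    (c := C (dz k n h) + C (dx k n h ^ n) * X) (by
      have h1 : aeval (C (dx k n h)) h = C (aeval (dx k n h) h) :=
        aeval_algebraMap_apply _ _ _
      have h2 := congrArg (C : _ → (DanRing k n h)[X]) (relation (k := k) (n := n) (h := h))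
      simp only [C_mul, C_add, C_pow] at h2
      rw [h1]
      simp only [C_mul, C_add, C_pow, C_ofNat]
      linear_combination h2)

theorem stdExp_dx : stdExp k n h (dx k n h) = C (dx k n h) := lift_dx _

theorem stdExp_dy : stdExp k n h (dy k n h) = C (dy k n h) +
    C (2 * dz k n h + aeval (dx k n h) h) * X + C (dx k n h ^ n) * X ^ 2 := lift_dy _

theorem stdExp_dz : stdExp k n h (dz k n h) = C (dz k n h) + C (dx k n h ^ n) * X := lift_dz _

theorem stdExp_aeval_dx (p : k[X]) :
    stdExp k n h (aeval (dx k n h) p) = C (aeval (dx k n h) p) := by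
  rw [← aeval_algHom_apply, stdExp_dx]
  exact aeval_algebraMap_apply _ _ _

theorem isExp_stdExp : IsExp (stdExp k n h) where
  coeff_zero r := by
    have H : constantCoeff.comp (stdExp k n h : DanRing k n h →+* (DanRing k n h)[X]) =
        RingHom.id _ := by
      refine ringHom_ext (fun a => ?_) ?_ ?_ ?_
      · simp [Polynomial.algebraMap_apply]
      · simp [stdExp_dx]
      · simp [stdExp_dy]
      · simp [stdExp_dz]
    exact DFunLike.congr_fun H r
  map_coeff r d := by
    have H : (mapRingHom (stdExp k n h : DanRing k n h →+* (DanRing k n h)[X])).comp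
        (stdExp k n h : DanRing k n h →+* (DanRing k n h)[X]) =
        ((taylorAlgHom (X : (DanRing k n h)[X])).toRingHom.comp (mapRingHom C)).comp
          (stdExp k n h : DanRing k n h →+* (DanRing k n h)[X]) := by
      let : CommRing (DanRing k n h)[X] := Polynomial.commRing
      refine ringHom_ext (A := (DanRing k n h)[X][X]) (fun a => ?_) ?_ ?_ ?_
      · simp [Polynomial.algebraMap_apply]
      · simp [stdExp_dx]
      · simp only [RingHom.comp_apply, RingHom.coe_coe, stdExp_dy, coe_mapRingHom, map_C, map_X,
          stdExp_dz, stdExp_aeval_dx, map_pow, stdExp_dx, AlgHom.toRingHom_eq_coe, map_add,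
          map_mul, taylorAlgHom_apply, taylor_C, taylor_X, map_ofNat]
        ring
      · simp [stdExp_dx, stdExp_dz]
        ring
    have H' := congrArg (fun P => P.coeff d) (DFunLike.congr_fun H r)
    simp only [RingHom.comp_apply, coe_mapRingHom, coeff_map, RingHom.coe_coe] at H'
    rw [H']
    change (taylor X ((stdExp k n h r).map C)).coeff d = _
    rw [taylor_coeff]
    have hmap : hasseDeriv d ((stdExp k n h r).map C) = (hasseDeriv d (stdExp k n h r)).map C := by
      ext1 i
      simp [hasseDeriv_coeff]
    rw [hmap, eval_map, eval₂_C_X]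

theorem IsExp.conj {R S : Type*} [CommRing R] [CommRing S] [Algebra k R] [Algebra k S]
    {φ : S →ₐ[k] S[X]} (hφ : IsExp φ) (e : R ≃ₐ[k] S) :
    IsExp ((mapAlgHom (e.symm : S →ₐ[k] R)).comp (φ.comp (e : R →ₐ[k] S))) where
  coeff_zero r := by simp [hφ.coeff_zero]
  map_coeff r d := by
    ext i
    simp [hφ.map_coeff, hasseDeriv_coeff]

variable {n' : ℕ} {h' : k[X]}

/-- An isomorphism maps `k[x]` onto `k[x]`. -/
theorem exists_map_dx (hn : 2 ≤ n) (e : DanRing k n h ≃ₐ[k] DanRing k n' h') :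
    ∃ p : k[X], e.symm (dx k n' h') = aeval (dx k n h) p := by
  refine exists_aeval_dx_eq hn ((isExp_stdExp (k := k) (n := n') (h := h')).conj e) ?_ ?_
  · refine ⟨e.symm (dz k n' h'), fun H => ?_⟩
    have := congrArg (fun P => P.coeff 1) H
    have h1 : (stdExp k n' h' (dz k n' h')).coeff 1 = dx k n' h' ^ n' := by
      rw [stdExp_dz, coeff_add, coeff_C_succ, coeff_C_mul, coeff_X_one, zero_add, mul_one]
    simp [h1, dx_ne_zero] at this
  · simp [stdExp_dx]

end StandardExp

section Isomorphism

variable {k : Type*} [Field k] {n : ℕ} {h : k[X]}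

theorem exists_eq_add_of_degree_lt {r : DanRing k n h} {m : ℕ}
    (hr : (emb k n h r).degree < (m + 1 : ℕ)) : ∃ (p : k[X]) (r' : DanRing k n h),
      r = aeval (dx k n h) p * mon k n h m + r' ∧ (emb k n h r').degree < m := by
  rcases eq_or_ne r 0 with rfl | hr0
  · exact ⟨0, 0, by simp, by simp⟩
  obtain ⟨d, p, r', hp, hrr', hd', hd, -⟩ := exists_leading r hr0
  rw [hd, Nat.cast_lt, Nat.lt_succ_iff] at hr
  rcases hr.eq_or_lt with rfl | hlt
  · exact ⟨p, r', hrr', hd'⟩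
  · exact ⟨0, r, by simp, by rw [hd]; exact_mod_cast hlt⟩

theorem exists_eq_of_degree_lt_one {r : DanRing k n h} (hr : (emb k n h r).degree < (1 : ℕ)) :
    ∃ p : k[X], r = aeval (dx k n h) p := by
  obtain ⟨p, r', hr', hd⟩ := exists_eq_add_of_degree_lt (m := 0) hr
  have : r' = 0 := by
    by_contra hne
    simpa using natDegree_emb_lt hne hd
  exact ⟨p, by rw [hr', this, mon_zero, mul_one, add_zero]⟩

theorem exists_eq_of_degree_lt_two {r : DanRing k n h} (hr : (emb k n h r).degree < (2 : ℕ)) :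
    ∃ q p : k[X], r = aeval (dx k n h) q * dz k n h + aeval (dx k n h) p := by
  obtain ⟨q, r', hr', hd⟩ := exists_eq_add_of_degree_lt (m := 1) hr
  obtain ⟨p, hp⟩ := exists_eq_of_degree_lt_one hd
  exact ⟨q, p, by rw [hr', hp, mon_one]⟩

theorem exists_eq_of_degree_lt_three {r : DanRing k n h} (hr : (emb k n h r).degree < (3 : ℕ)) :
    ∃ a b c : k[X], r = aeval (dx k n h) a * dy k n h + aeval (dx k n h) b * dz k n h +
      aeval (dx k n h) c := by
  obtain ⟨a, r', hr', hd⟩ := exists_eq_add_of_degree_lt (m := 2) hr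
  obtain ⟨b, c, hbc⟩ := exists_eq_of_degree_lt_two hd
  exact ⟨a, b, c, by rw [hr', hbc, mon_two, add_assoc]⟩

theorem eq_zero_of_add_eq_zero {a b c : k[X]} (H : aeval (dx k n h) a * dy k n h +
    aeval (dx k n h) b * dz k n h + aeval (dx k n h) c = 0) : a = 0 ∧ b = 0 ∧ c = 0 := by
  have hinj (p : k[X]) (hp : algebraMap k[X] (RatFunc k) (expand k 2 p) = 0) : p = 0 := by
    by_contra hne
    exact algebraMap_expand_ne_zero hne hp
  have H' := congrArg (emb k n h) H
  simp only [map_add, map_mul, map_zero, emb_aeval_dx, emb_dy, emb_dz] at H'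
  have h0 := congrArg (fun P => P.coeff 0) H'
  have h1 := congrArg (fun P => P.coeff 1) H'
  have h2 := congrArg (fun P => P.coeff 2) H'
  simp only [coeff_add, coeff_C_mul, coeff_X_pow, coeff_X, coeff_C, coeff_zero] at h0 h1 h2
  norm_num at h2
  have ha := hinj a (by simpa using h2)
  subst ha
  norm_num [RatFunc.X_ne_zero] at h1
  norm_num at h0
  exact ⟨rfl, hinj b (by simpa using h1), hinj c (by simpa using h0)⟩

theorem aeval_dx_injective : Function.Injective (aeval (R := k) (dx k n h)) := by
  rw [injective_iff_map_eq_zero]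
  intro p hp
  by_contra hne
  exact aeval_dx_ne_zero hne hp

/-- A homomorphism to `K[w]` that sends `k[x]` to constants scales degrees. -/
theorem natDegree_hom {K : Type*} [Field K] (f : DanRing k n h →+* K[X]) (hf : Function.Injective f)
    (hx : ∀ p : k[X], (f (aeval (dx k n h) p)).natDegree = 0) (r : DanRing k n h) :
    (f r).natDegree = (f (dz k n h)).natDegree * (emb k n h r).natDegree := by
  set a := (f (dz k n h)).natDegree with ha
  have hne {r : DanRing k n h} (hr : r ≠ 0) : f r ≠ 0 := (map_ne_zero_iff _ hf).2 hr
  have hzne : dz k n h + aeval (dx k n h) h ≠ 0 := by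
    intro H
    have := eq_zero_of_add_eq_zero (k := k) (n := n) (h := h) (a := 0) (b := 1) (c := h)
      (by simpa using H)
    exact one_ne_zero this.2.1
  have hz : (f (dz k n h + aeval (dx k n h) h)).natDegree = a := by
    have := hx h
    rw [map_add, natDegree_eq_zero.1 this |>.choose_spec.symm, natDegree_add_C]
  have hy : (f (dy k n h)).natDegree = 2 * a := by
    have H := congrArg (fun r => (f r).natDegree) (relation (k := k) (n := n) (h := h))
    have hx1 := hx X
    rw [aeval_X] at hx1
    rw [show dz k n h ^ 2 + aeval (dx k n h) h * dz k n h =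
      dz k n h * (dz k n h + aeval (dx k n h) h) by ring, map_mul, map_mul, map_pow,
      natDegree_mul (pow_ne_zero _ (hne dx_ne_zero)) (hne dy_ne_zero), natDegree_pow, hx1,
      natDegree_mul (hne dz_ne_zero) (hne hzne), hz, ← ha] at H
    lia
  have hmon (d : ℕ) : (f (mon k n h d)).natDegree = a * d := by
    rw [mon, map_mul, map_pow, map_pow, natDegree_mul (pow_ne_zero _ (hne dy_ne_zero))
      (pow_ne_zero _ (hne dz_ne_zero)), natDegree_pow, natDegree_pow, hy, ← ha]
    conv_rhs => rw [← Nat.div_add_mod d 2]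
    ring
  induction hN : (emb k n h r).natDegree using Nat.strong_induction_on generalizing r with
  | _ N ih =>
    rcases eq_or_ne r 0 with rfl | hr0
    · simp [← hN]
    obtain ⟨d, p, r', hp, hr', hd', hd, -⟩ := exists_leading r hr0
    rw [natDegree_eq_of_degree_eq_some hd] at hN
    subst hN
    have hmon0 : mon k n h d ≠ 0 :=
      mul_ne_zero (pow_ne_zero _ dy_ne_zero) (pow_ne_zero _ dz_ne_zero)
    have hlead : (f (aeval (dx k n h) p * mon k n h d)).natDegree = a * d := by
      rw [map_mul, natDegree_mul (hne (aeval_dx_ne_zero hp)) (hne hmon0), hx, hmon, zero_add]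
    rcases eq_or_ne r' 0 with rfl | hr'0
    · rw [hr', add_zero, hlead]
    have hlt := natDegree_emb_lt hr'0 hd'
    have hr'deg := ih _ hlt r' rfl
    rcases Nat.eq_zero_or_pos a with h0 | hpos
    · rw [h0, zero_mul] at hr'deg hlead ⊢
      rw [hr', map_add]
      have := natDegree_add_le (f (aeval (dx k n h) p * mon k n h d)) (f r')
      rw [hlead, hr'deg] at this
      simpa using this
    · rw [hr', map_add, natDegree_add_eq_left_of_natDegree_lt, hlead]
      rw [hlead, hr'deg]
      exact Nat.mul_lt_mul_of_pos_left hlt hpos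

/-- `k[x,y,z]/(x - c) = k[z]` for `c ≠ 0`. -/
def fiberHom (n : ℕ) (h : k[X]) {c : k} (hc : c ≠ 0) : DanRing k n h →ₐ[k] k[X] :=
  lift (a := C c) (b := C (c ^ n)⁻¹ * (X ^ 2 + C (h.eval c) * X)) (c := X) (by
    have h1 : aeval (C c) h = C (h.eval c) := by
      rw [← algebraMap_eq, aeval_algebraMap_apply, coe_aeval_eq_eval]
    rw [h1, ← mul_assoc, ← C_pow, ← C_mul, mul_inv_cancel₀ (pow_ne_zero _ hc), C_1, one_mul])

theorem dvd_of_fiberHom_eq_zero {c : k} (hc : c ≠ 0) {r : DanRing k n h}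
    (hr : fiberHom n h hc r = 0) : dx k n h - algebraMap k _ c ∣ r := by
  let I : Ideal (DanRing k n h) := Ideal.span {dx k n h - algebraMap k _ c}
  let π : DanRing k n h →+* DanRing k n h ⧸ I := Ideal.Quotient.mk I
  have hx : π (dx k n h) = π (algebraMap k _ c) := by
    rw [← sub_eq_zero, ← map_sub]
    exact Ideal.Quotient.eq_zero_iff_mem.2 (Ideal.subset_span rfl)
  let σ : k[X] →+* DanRing k n h ⧸ I := eval₂RingHom (π.comp (algebraMap k _)) (π (dz k n h))
  have hσC (a : k) : σ (C a) = π (algebraMap k _ a) := eval₂_C _ _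
  have hσX : σ X = π (dz k n h) := eval₂_X _ _
  have hh : π (aeval (dx k n h) h) = σ (C (h.eval c)) := by
    rw [hσC, aeval_def, hom_eval₂, hx, ← hom_eval₂, eval₂_at_apply]
  have H : σ.comp (fiberHom n h hc : DanRing k n h →+* k[X]) = π := by
    refine ringHom_ext (A := DanRing k n h ⧸ I) (fun a => ?_) ?_ ?_ ?_
    · rw [RingHom.comp_apply, RingHom.coe_coe, AlgHom.commutes, algebraMap_eq, hσC]
    · rw [RingHom.comp_apply, RingHom.coe_coe, fiberHom, lift_dx, hσC, hx]
    · rw [RingHom.comp_apply, RingHom.coe_coe, fiberHom, lift_dy, map_mul, map_add, map_pow,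
        map_mul, hσX, ← hh, ← map_pow, ← map_mul, ← map_add, ← relation, map_mul, map_pow, hx, ← map_pow,
        ← map_pow, hσC, ← mul_assoc, ← map_mul, ← map_mul, ← map_mul,
        inv_mul_cancel₀ (pow_ne_zero _ hc), map_one, one_mul]
    · rw [RingHom.comp_apply, RingHom.coe_coe, fiberHom, lift_dz, hσX]
  have : π r = 0 := by
    rw [← H, RingHom.comp_apply, RingHom.coe_coe, hr, map_zero]
  exact Ideal.mem_span_singleton.1 (Ideal.Quotient.eq_zero_iff_mem.1 this)

theorem not_dx_dvd_dz (h0 : h.coeff 0 ≠ 0) : ¬ dx k n h ∣ dz k n h := by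
  rintro ⟨r, hr⟩
  have H : (0 : k) ^ n * 0 = (-h.coeff 0) ^ 2 + aeval (0 : k) h * (-h.coeff 0) := by
    rw [coe_aeval_eq_eval, ← coeff_zero_eq_eval_zero]
    ring
  have := congrArg (lift H) hr
  rw [map_mul, lift_dx, lift_dz, zero_mul, neg_eq_zero] at this
  exact h0 this

theorem not_dx_dvd_dz_add (h0 : h.coeff 0 ≠ 0) :
    ¬ dx k n h ∣ dz k n h + aeval (dx k n h) h := by
  rintro ⟨r, hr⟩
  have H : (0 : k) ^ n * 0 = 0 ^ 2 + aeval (0 : k) h * 0 := by simp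
  have := congrArg (lift H) hr
  rw [map_mul, lift_dx, map_add, ← aeval_algHom_apply, lift_dx, lift_dz, zero_mul, zero_add,
    coe_aeval_eq_eval, ← coeff_zero_eq_eval_zero] at this
  exact h0 this

end Isomorphism

section Classification

variable {k : Type*} [Field k] {n₁ n₂ : ℕ} {h₁ h₂ : k[X]}

theorem map_dx_eq (hn₁ : 2 ≤ n₁) (hn₂ : 2 ≤ n₂) (h₂0 : h₂.coeff 0 ≠ 0)
    (e : DanRing k n₁ h₁ ≃ₐ[k] DanRing k n₂ h₂) :
    ∃ μ : k, μ ≠ 0 ∧ e.symm (dx k n₂ h₂) = aeval (dx k n₁ h₁) (C μ * X) := by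
  obtain ⟨p, hp⟩ := exists_map_dx hn₁ e
  obtain ⟨q, hq⟩ := exists_map_dx hn₂ e.symm
  rw [AlgEquiv.symm_symm] at hq
  have hpq : p.comp q = X := by
    apply aeval_dx_injective (n := n₂) (h := h₂)
    rw [aeval_comp, ← hq, aeval_X]
    refine (aeval_algHom_apply e.toAlgHom _ _).trans ?_
    change e _ = _
    rw [← hp, e.apply_symm_apply]
  have hdeg : p.natDegree = 1 := by
    have := congrArg natDegree hpq
    rw [natDegree_comp, natDegree_X] at this
    exact Nat.eq_one_of_mul_eq_one_right this
  obtain ⟨μ, hμ, ν, rfl⟩ := natDegree_eq_one.1 hdeg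
  refine ⟨μ, hμ, ?_⟩
  suffices ν = 0 by rw [hp, this, C_0, add_zero]
  by_contra hν
  have hc : -ν / μ ≠ 0 := div_ne_zero (neg_ne_zero.2 hν) hμ
  have hx : e.symm (dx k n₂ h₂) =
      algebraMap k _ μ * (dx k n₁ h₁ - algebraMap k _ (-ν / μ)) := by
    rw [hp, map_add, map_mul, aeval_C, aeval_C, aeval_X, mul_sub, ← map_mul,
      mul_div_cancel₀ _ hμ, map_neg, sub_neg_eq_add]
  have hdvd {r : DanRing k n₂ h₂} (hr : fiberHom n₁ h₁ hc (e.symm r) = 0) : dx k n₂ h₂ ∣ r := by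
    obtain ⟨s, hs⟩ := dvd_of_fiberHom_eq_zero hc hr
    refine ⟨e (algebraMap k _ μ⁻¹ * s), e.symm.injective ?_⟩
    have hμμ : algebraMap k (DanRing k n₁ h₁) μ * algebraMap k _ μ⁻¹ = 1 := by
      rw [← map_mul, mul_inv_cancel₀ hμ, map_one]
    rw [map_mul, e.symm_apply_apply, hx, hs]
    linear_combination (-(dx k n₁ h₁ - algebraMap k _ (-ν / μ)) * s) * hμμ
  have hzero : fiberHom n₁ h₁ hc (e.symm (dz k n₂ h₂)) *
      fiberHom n₁ h₁ hc (e.symm (dz k n₂ h₂ + aeval (dx k n₂ h₂) h₂)) = 0 := by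
    rw [← map_mul, ← map_mul, mul_add, mul_comm _ (aeval _ _), ← sq, ← relation, map_mul, map_mul,
      map_pow, map_pow, hx, map_mul, map_sub, AlgHom.commutes, AlgHom.commutes, fiberHom, lift_dx,
      algebraMap_eq, sub_self, mul_zero, zero_pow (by lia), zero_mul]
  rcases mul_eq_zero.1 hzero with H | H
  · exact not_dx_dvd_dz h₂0 (hdvd H)
  · exact not_dx_dvd_dz_add h₂0 (hdvd H)

theorem map_aeval_dx {μ : k} {e : DanRing k n₁ h₁ ≃ₐ[k] DanRing k n₂ h₂}
    (hμ : e.symm (dx k n₂ h₂) = aeval (dx k n₁ h₁) (C μ * X)) (p : k[X]) :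
    e.symm (aeval (dx k n₂ h₂) p) = aeval (dx k n₁ h₁) (p.comp (C μ * X)) := by
  rw [aeval_comp, ← hμ]
  exact (aeval_algHom_apply e.symm.toAlgHom _ _).symm

theorem natDegree_emb_symm {μ : k} {e : DanRing k n₁ h₁ ≃ₐ[k] DanRing k n₂ h₂}
    (hμ : e.symm (dx k n₂ h₂) = aeval (dx k n₁ h₁) (C μ * X)) (r : DanRing k n₂ h₂) :
    (emb k n₁ h₁ (e.symm r)).natDegree = (emb k n₂ h₂ r).natDegree := by
  have H := natDegree_hom
    ((emb k n₁ h₁).comp (e.symm : DanRing k n₂ h₂ →ₐ[k] DanRing k n₁ h₁)).toRingHom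
    (fun a b hab => e.symm.injective (emb_injective hab)) (fun p => by
      change (emb k n₁ h₁ (e.symm _)).natDegree = 0
      rw [map_aeval_dx hμ, emb_aeval_dx, natDegree_C])
  change ∀ r, (emb k n₁ h₁ (e.symm r)).natDegree =
    (emb k n₁ h₁ (e.symm (dz k n₂ h₂))).natDegree * _ at H
  have h1 := H (e (dz k n₁ h₁))
  rw [e.symm_apply_apply, natDegree_emb_dz, eq_comm] at h1
  rw [H, Nat.eq_one_of_mul_eq_one_right h1, one_mul]

theorem map_dz_eq {μ μ' : k} {e : DanRing k n₁ h₁ ≃ₐ[k] DanRing k n₂ h₂}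
    (hμ : e.symm (dx k n₂ h₂) = aeval (dx k n₁ h₁) (C μ * X))
    (hμ' : e (dx k n₁ h₁) = aeval (dx k n₂ h₂) (C μ' * X)) :
    ∃ η : k, η ≠ 0 ∧ ∃ p : k[X],
      e.symm (dz k n₂ h₂) = aeval (dx k n₁ h₁) (C η) * dz k n₁ h₁ + aeval (dx k n₁ h₁) p := by
  have h1 : (emb k n₁ h₁ (e.symm (dz k n₂ h₂))).degree < (2 : ℕ) := by
    refine degree_le_natDegree.trans_lt ?_
    rw [natDegree_emb_symm hμ, natDegree_emb_dz]
    exact_mod_cast Nat.one_lt_two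
  have h2 : (emb k n₂ h₂ (e (dz k n₁ h₁))).degree < (2 : ℕ) := by
    refine degree_le_natDegree.trans_lt ?_
    have := natDegree_emb_symm (e := e.symm) (by rwa [e.symm_symm]) (dz k n₁ h₁)
    rw [AlgEquiv.symm_symm] at this
    rw [this, natDegree_emb_dz]
    exact_mod_cast Nat.one_lt_two
  obtain ⟨q, p, hqp⟩ := exists_eq_of_degree_lt_two h1
  obtain ⟨q', p', hqp'⟩ := exists_eq_of_degree_lt_two h2
  have h3 := congrArg e.symm hqp'
  rw [e.symm_apply_apply, map_add, map_mul, map_aeval_dx hμ, map_aeval_dx hμ, hqp] at h3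
  have h4 := eq_zero_of_add_eq_zero (k := k) (n := n₁) (h := h₁) (a := 0)
    (b := q'.comp (C μ * X) * q - 1) (c := q'.comp (C μ * X) * p + p'.comp (C μ * X)) (by
      simp only [map_zero, map_sub, map_mul, map_add, map_one]
      linear_combination -h3)
  have hq : IsUnit q := IsUnit.of_mul_eq_one_right _ (sub_eq_zero.1 h4.2.1)
  obtain ⟨η, hη, rfl⟩ := isUnit_iff.1 hq
  exact ⟨η, hη.ne_zero, p, hqp⟩

/-- The constraints obtained by writing the images of `x, y, z` under an isomorphism in the standard
basis. -/
theorem exists_relations (hn₁ : 2 ≤ n₁) (hn₂ : 2 ≤ n₂) (h₁0 : h₁.coeff 0 ≠ 0)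
    (h₂0 : h₂.coeff 0 ≠ 0) (e : DanRing k n₁ h₁ ≃ₐ[k] DanRing k n₂ h₂) :
    ∃ η μ : k, η ≠ 0 ∧ μ ≠ 0 ∧ ∃ a b c p : k[X],
      C (μ ^ n₂) * X ^ n₂ * a = C (η ^ 2) * X ^ n₁ ∧
      C (μ ^ n₂) * X ^ n₂ * b =
        C η * h₂.comp (C μ * X) + 2 * C η * p - C (η ^ 2) * h₁ ∧
      C (μ ^ n₂) * X ^ n₂ * c = p * (p + h₂.comp (C μ * X)) := by
  obtain ⟨μ, hμ0, hμ⟩ := map_dx_eq hn₁ hn₂ h₂0 e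
  obtain ⟨μ', -, hμ'⟩ := map_dx_eq hn₂ hn₁ h₁0 e.symm
  obtain ⟨η, hη, p, hp⟩ := map_dz_eq hμ (by rwa [e.symm_symm] at hμ')
  have h3 : (emb k n₁ h₁ (e.symm (dy k n₂ h₂))).degree < (3 : ℕ) := by
    refine degree_le_natDegree.trans_lt ?_
    rw [natDegree_emb_symm hμ, natDegree_emb_dy]
    exact_mod_cast Nat.lt_succ_self 2
  obtain ⟨a, b, c, habc⟩ := exists_eq_of_degree_lt_three h3
  have hrel := congrArg e.symm (relation (k := k) (n := n₂) (h := h₂))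
  rw [map_mul, map_pow, map_add, map_mul, map_pow, map_aeval_dx hμ, hμ, habc, hp] at hrel
  have hrel₁ := relation (k := k) (n := n₁) (h := h₁)
  have H := eq_zero_of_add_eq_zero (k := k) (n := n₁) (h := h₁)
    (a := C (μ ^ n₂) * X ^ n₂ * a - C (η ^ 2) * X ^ n₁)
    (b := C (μ ^ n₂) * X ^ n₂ * b - (C η * h₂.comp (C μ * X) + 2 * C η * p - C (η ^ 2) * h₁))
    (c := C (μ ^ n₂) * X ^ n₂ * c - p * (p + h₂.comp (C μ * X))) (by
      simp only [map_sub, map_mul, map_pow, map_add, aeval_X, map_ofNat, mul_pow] at hrel ⊢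
      linear_combination hrel - aeval (dx k n₁ h₁) (C η) ^ 2 * hrel₁)
  exact ⟨η, μ, hη, hμ0, a, b, c, p, sub_eq_zero.1 H.1, sub_eq_zero.1 H.2.1, sub_eq_zero.1 H.2.2⟩

theorem le_of_algEquiv (hn₁ : 2 ≤ n₁) (hn₂ : 2 ≤ n₂) (h₁0 : h₁.coeff 0 ≠ 0)
    (h₂0 : h₂.coeff 0 ≠ 0) (e : DanRing k n₁ h₁ ≃ₐ[k] DanRing k n₂ h₂) : n₂ ≤ n₁ := by
  obtain ⟨η, μ, hη, hμ, a, b, c, p, H, -⟩ := exists_relations hn₁ hn₂ h₁0 h₂0 e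
  have hdvd : (X : k[X]) ^ n₂ ∣ C (η ^ 2) * X ^ n₁ := by
    rw [← H]
    exact (dvd_mul_left _ _).mul_right _
  rw [IsUnit.dvd_mul_left (isUnit_C.2 (pow_ne_zero 2 hη).isUnit),
    pow_dvd_pow_iff X_ne_zero not_isUnit_X] at hdvd
  exact hdvd

end Classification

end DanRing

/-- If `R₁ ≅ R₂` as `k`-algebras, then `n₁ = n₂` and `h₂(X) = η h₁(μX)` for some
`η, μ ∈ k*`. -/
theorem stmt_17 (k : Type*) [Field k] (n₁ n₂ : ℕ) (hn₁ : 2 ≤ n₁) (hn₂ : 2 ≤ n₂)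
    (h₁ h₂ : Polynomial k) (h₁0 : h₁.coeff 0 ≠ 0) (h₂0 : h₂.coeff 0 ≠ 0)
    (hdeg₁ : h₁.natDegree < n₁) (hdeg₂ : h₂.natDegree < n₂)
    (hiso : Nonempty (DanRing k n₁ h₁ ≃ₐ[k] DanRing k n₂ h₂)) :
    n₁ = n₂ ∧ ∃ η μ : k, η ≠ 0 ∧ μ ≠ 0 ∧
      h₂ = Polynomial.C η * h₁.comp (Polynomial.C μ * Polynomial.X) := by
  obtain ⟨e⟩ := hiso
  obtain rfl : n₁ = n₂ := le_antisymm (DanRing.le_of_algEquiv hn₂ hn₁ h₂0 h₁0 e.symm)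
    (DanRing.le_of_algEquiv hn₁ hn₂ h₁0 h₂0 e)
  refine ⟨rfl, ?_⟩
  obtain ⟨η, μ, hη, hμ, a, b, c, p, -, hb, hc⟩ := DanRing.exists_relations hn₁ hn₂ h₁0 h₂0 e
  set H := h₂.comp (Polynomial.C μ * Polynomial.X) with hH
  have hHdeg : H.natDegree < n₁ := by
    rwa [hH, Polynomial.natDegree_comp, Polynomial.natDegree_C_mul_X _ hμ, mul_one]
  have hH0 : ¬ Polynomial.X ∣ H := by
    rw [Polynomial.X_dvd_iff, hH, Polynomial.coeff_zero_eq_eval_zero, Polynomial.eval_comp]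
    simpa [← Polynomial.coeff_zero_eq_eval_zero] using h₂0
  have hdvd_b : (Polynomial.X : Polynomial k) ^ n₁ ∣ Polynomial.C η * H +
      2 * Polynomial.C η * p - Polynomial.C (η ^ 2) * h₁ := by
    rw [← hb]
    exact (dvd_mul_left _ _).mul_right _
  have hdvd_c : (Polynomial.X : Polynomial k) ^ n₁ ∣ p * (p + H) := by
    rw [← hc]
    exact (dvd_mul_left _ _).mul_right _
  have hsmall {ε : k} (h : (Polynomial.X : Polynomial k) ^ n₁ ∣ H - Polynomial.C ε * h₁) :
      H = Polynomial.C ε * h₁ := by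
    rw [← sub_eq_zero]
    refine Polynomial.eq_zero_of_dvd_of_natDegree_lt h ?_
    rw [Polynomial.natDegree_X_pow]
    exact (Polynomial.natDegree_sub_le _ _).trans_lt
      (max_lt hHdeg ((Polynomial.natDegree_C_mul_le _ _).trans_lt hdeg₁))
  have hC : Polynomial.C η⁻¹ * Polynomial.C η = 1 := by
    rw [← Polynomial.C_mul, inv_mul_cancel₀ hη, Polynomial.C_1]
  obtain ⟨ε, hε, hHε⟩ : ∃ ε : k, ε ≠ 0 ∧ H = Polynomial.C ε * h₁ := by
    by_cases hp : Polynomial.X ∣ p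
    · have hpH : ¬ Polynomial.X ∣ p + H := fun h => hH0 ((dvd_add_right hp).1 h)
      have hpn := Polynomial.prime_X.pow_dvd_of_dvd_mul_right n₁ hpH hdvd_c
      refine ⟨η, hη, hsmall ?_⟩
      have := dvd_sub (hdvd_b.mul_left (Polynomial.C η⁻¹)) (hpn.mul_left 2)
      convert this using 1
      rw [Polynomial.C_pow]
      linear_combination (Polynomial.C η * h₁ - H - 2 * p) * hC
    · have hpn := Polynomial.prime_X.pow_dvd_of_dvd_mul_left n₁ hp hdvd_c
      refine ⟨-η, neg_ne_zero.2 hη, hsmall ?_⟩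
      have := dvd_sub (hpn.mul_left 2) (hdvd_b.mul_left (Polynomial.C η⁻¹))
      convert this using 1
      rw [Polynomial.C_pow, Polynomial.C_neg]
      linear_combination (-Polynomial.C η * h₁ + H + 2 * p) * hC
  refine ⟨ε, μ⁻¹, hε, inv_ne_zero hμ, ?_⟩
  have hcomp := congrArg (fun P => P.comp (Polynomial.C μ⁻¹ * Polynomial.X)) hHε
  simp only [hH, Polynomial.comp_assoc, Polynomial.mul_comp, Polynomial.C_comp,
    Polynomial.X_comp] at hcomp
  rwa [← mul_assoc, ← Polynomial.C_mul, mul_inv_cancel₀ hμ, Polynomial.C_1, one_mul,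
    Polynomial.comp_X] at hcomp
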